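/- For every n ≥ 1, there exists a (2,1)-separating code C ⊆ {0,1}^n (with respect to the Hamming metric) of cardinality |C| ≥ ⌊(1/2)·(2/√3)^n⌋; that is, the maximal cardinality κ(n) of a binary (2,1)-separating system of length n satisfies κ(n) ≥ ⌊(1/2)·(2/√3)^n⌋. -/

import Mathlib

variable {n : ℕ}

/-- The metric segment `[x,y]` in the Hamming space `{0,1}^n`. -/
def hammingSeg (x y : Fin n → Bool) : Set (Fin n → Bool) :=
  {z | hammingDist x y = hammingDist x z + hammingDist z y}

/-- A subset `K ⊆ {0,1}^n` is Hamming-convex if it contains the Hamming segment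
between any two of its points. -/
def HammingConvex (K : Set (Fin n → Bool)) : Prop :=
  ∀ x ∈ K, ∀ y ∈ K, hammingSeg x y ⊆ K

/-- The smallest Hamming-convex set containing `S`. -/
def hammingHull (S : Set (Fin n → Bool)) : Set (Fin n → Bool) :=
  ⋂₀ {K : Set (Fin n → Bool) | HammingConvex K ∧ S ⊆ K}

/-- `C ⊆ {0,1}^n` is Hamming `(s,t)`-separating. -/
def HammingSeparating (s t : ℕ) (C : Set (Fin n → Bool)) : Prop :=
  ∀ S T : Finset (Fin n → Bool), ↑S ⊆ C → ↑T ⊆ C → S.card ≤ s → T.card ≤ t →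
    Disjoint S T → hammingHull (↑S : Set (Fin n → Bool)) ∩ hammingHull ↑T = ∅

theorem hammingConvex_coordinate (i : Fin n) (b : Bool) :
    HammingConvex {w : Fin n → Bool | w i = b} := by
  intro u hu v hv w hw
  by_contra hne
  simp only [Set.mem_ofPred_eq] at hu hv hne
  have hlt : hammingDist u v < hammingDist u w + hammingDist w v := by
    simp only [hammingDist, Finset.card_filter]
    rw [← Finset.sum_add_distrib]
    refine Finset.sum_lt_sum (fun j _ => ?_) ⟨i, Finset.mem_univ i, ?_⟩
    · by_cases h₁ : u j = w j <;> by_cases h₂ : w j = v j <;> simp [h₁, h₂]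
      split_ifs <;> omega
    · rw [hu, hv]
      simp [Ne.symm hne]
  exact absurd hw hlt.ne

theorem hammingHull_subset {S K : Set (Fin n → Bool)} (hK : HammingConvex K) (h : S ⊆ K) :
    hammingHull S ⊆ K :=
  Set.sInter_subset_of_mem ⟨hK, h⟩

theorem hammingHull_empty : hammingHull (∅ : Set (Fin n → Bool)) = ∅ :=
  Set.subset_empty_iff.1
    (hammingHull_subset (fun _ h => absurd h (Set.notMem_empty _)) (Set.empty_subset _))

/-- The coordinatewise criterion for `(2,1)`-separation. -/
theorem hammingSeparating_two_one_of_coordinate {C : Set (Fin n → Bool)}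
    (hC : ∀ x ∈ C, ∀ y ∈ C, ∀ z ∈ C, z ≠ x → z ≠ y → ∃ i, z i ≠ x i ∧ z i ≠ y i) :
    HammingSeparating 2 1 C := by
  intro S T hS hT hSc hTc hdisj
  rcases T.eq_empty_or_nonempty with rfl | ⟨z, hz⟩
  · simp [hammingHull_empty]
  rcases S.eq_empty_or_nonempty with rfl | ⟨x, hx⟩
  · simp [hammingHull_empty]
  have hT_eq : ∀ t ∈ T, t = z := fun t ht => Finset.card_le_one.1 hTc t ht z hz
  obtain ⟨y, hy, hSxy⟩ : ∃ y ∈ S, ∀ s ∈ S, s = x ∨ s = y := by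
    by_cases h : ∃ y ∈ S, y ≠ x
    · obtain ⟨y, hy, hyx⟩ := h
      refine ⟨y, hy, fun s hs => ?_⟩
      by_contra! hne
      have : 2 < S.card := Finset.two_lt_card.2
        ⟨x, hx, y, hy, s, hs, hyx.symm, hne.1.symm, hne.2.symm⟩
      omega
    · push Not at h
      exact ⟨x, hx, fun s hs => Or.inl (h s hs)⟩
  have hzS : ∀ s ∈ S, z ≠ s := fun s hs h => Finset.disjoint_left.1 hdisj hs (h ▸ hz)
  obtain ⟨i, hix, hiy⟩ :=
    hC x (hS hx) y (hS hy) z (hT hz) (hzS x hx) (hzS y hy)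
  refine Set.eq_empty_of_forall_notMem fun w ⟨hwS, hwT⟩ => ?_
  have h₁ : w i = !z i := by
    refine hammingHull_subset (hammingConvex_coordinate i (!z i)) (fun s hs => ?_) hwS
    rcases hSxy s hs with rfl | rfl
    · exact Bool.eq_not.2 hix.symm
    · exact Bool.eq_not.2 hiy.symm
  have h₂ : w i = z i :=
    hammingHull_subset (hammingConvex_coordinate i (z i)) (fun t ht => by
      rw [hT_eq t ht]; rfl) hwT
  simp [h₂] at h₁

/-- At least a quarter of all Boolean functions separate `i` from both `j` and `k`. -/
theorem two_pow_card_le_four_mul_card_separating {ι : Type*} [Fintype ι] [DecidableEq ι]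
    {i j k : ι} (hij : i ≠ j) (hik : i ≠ k) :
    2 ^ Fintype.card ι ≤
      4 * (Finset.univ.filter fun g : ι → Bool => g i ≠ g j ∧ g i ≠ g k).card := by
  have h := Finset.card_le_card_of_injOn (s := (Finset.univ : Finset (ι → Bool)))
    (t := (Finset.univ.filter fun g : ι → Bool => g i ≠ g j ∧ g i ≠ g k) ×ˢ
      (Finset.univ : Finset (Bool × Bool)))
    (fun g => (Function.update (Function.update g j (!g i)) k (!g i), g j, g k))
    (fun g _ => by
      by_cases hjk : j = k
      · subst hjk
        simp [hij]
      · simp [hij, hik, hjk])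
    (fun g _ g' _ hgg' => by
      simp only [Prod.mk.injEq] at hgg'
      obtain ⟨h₁, h₂, h₃⟩ := hgg'
      funext m
      by_cases hmk : m = k
      · rw [hmk, h₃]
      by_cases hmj : m = j
      · rw [hmj, h₂]
      simpa [hmk, hmj] using congrFun h₁ m)
  simp only [Finset.card_product, Finset.card_univ, Fintype.card_prod, Fintype.card_bool,
    Fintype.card_fun] at h
  omega

theorem four_mul_card_nonseparating_le {ι : Type*} [Fintype ι] [DecidableEq ι]
    {i j k : ι} (hij : i ≠ j) (hik : i ≠ k) :
    4 * (Finset.univ.filter fun g : ι → Bool => ¬ (g i ≠ g j ∧ g i ≠ g k)).card ≤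
      3 * 2 ^ Fintype.card ι := by
  have h := two_pow_card_le_four_mul_card_separating hij hik
  have h' := Finset.card_filter_add_card_filter_not (s := (Finset.univ : Finset (ι → Bool)))
    (fun g => g i ≠ g j ∧ g i ≠ g k)
  simp only [Finset.card_univ, Fintype.card_fun, Fintype.card_bool] at h'
  omega

/-- The triples `(i, j, k)` with `j < k` and `i ∉ {j, k}`. -/
def pointedPairs (M : ℕ) : Finset (Fin M × Fin M × Fin M) :=
  Finset.univ.filter fun t => t.1 ≠ t.2.1 ∧ t.1 ≠ t.2.2 ∧ t.2.1 < t.2.2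

theorem two_mul_card_pointedPairs_le (M : ℕ) : 2 * (pointedPairs M).card ≤ M ^ 3 := by
  let e : Fin M × Fin M × Fin M ↪ Fin M × Fin M × Fin M :=
    ⟨fun t => (t.1, t.2.2, t.2.1), fun s t h => by
      simp only [Prod.mk.injEq] at h
      exact Prod.ext h.1 (Prod.ext h.2.2 h.2.1)⟩
  have hdisj : Disjoint (pointedPairs M) ((pointedPairs M).map e) := by
    rw [Finset.disjoint_left]
    intro t ht ht'
    obtain ⟨s, hs, rfl⟩ := Finset.mem_map.1 ht'
    simp only [pointedPairs, Finset.mem_filter, Finset.mem_univ, true_and] at ht hs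
    exact lt_asymm ht.2.2 hs.2.2
  have h := Finset.card_le_univ (pointedPairs M ∪ (pointedPairs M).map e)
  rw [Finset.card_union_of_disjoint hdisj, Finset.card_map] at h
  simp only [Fintype.card_prod, Fintype.card_fin] at h
  calc 2 * (pointedPairs M).card ≤ M * (M * M) := by omega
    _ = M ^ 3 := by ring

/-- The triples in `pointedPairs M` separated by no column of the `M × n` matrix with
columns `f c`. -/
def nonseparatedTriples {M : ℕ} (f : Fin n → Fin M → Bool) : Finset (Fin M × Fin M × Fin M) :=
  (pointedPairs M).filter fun t => ∀ c, ¬ (f c t.1 ≠ f c t.2.1 ∧ f c t.1 ≠ f c t.2.2)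

theorem exists_two_mul_card_nonseparatedTriples_le {M : ℕ} (hM : M ^ 2 * 3 ^ n ≤ 4 ^ n) :
    ∃ f : Fin n → Fin M → Bool, 2 * (nonseparatedTriples f).card ≤ M := by
  by_contra! hcon
  have hswap : ∑ f : Fin n → Fin M → Bool, (nonseparatedTriples f).card =
      ∑ t ∈ pointedPairs M, (Finset.univ.filter fun f : Fin n → Fin M → Bool =>
        ∀ c, ¬ (f c t.1 ≠ f c t.2.1 ∧ f c t.1 ≠ f c t.2.2)).card := by
    simp only [nonseparatedTriples, Finset.card_filter]
    exact Finset.sum_comm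
  have hterm : ∀ t ∈ pointedPairs M,
      4 ^ n * (Finset.univ.filter fun f : Fin n → Fin M → Bool =>
        ∀ c, ¬ (f c t.1 ≠ f c t.2.1 ∧ f c t.1 ≠ f c t.2.2)).card ≤ (3 * 2 ^ M) ^ n := by
    intro t ht
    simp only [pointedPairs, Finset.mem_filter, Finset.mem_univ, true_and] at ht
    have hpi : (Finset.univ.filter fun f : Fin n → Fin M → Bool =>
        ∀ c, ¬ (f c t.1 ≠ f c t.2.1 ∧ f c t.1 ≠ f c t.2.2)) =
        Fintype.piFinset fun _ : Fin n => Finset.univ.filter fun g : Fin M → Bool =>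
          ¬ (g t.1 ≠ g t.2.1 ∧ g t.1 ≠ g t.2.2) := by
      ext f
      simp only [Finset.mem_filter, Finset.mem_univ, true_and, Fintype.mem_piFinset]
    rw [hpi, Fintype.card_piFinset, Finset.prod_const, Finset.card_univ, Fintype.card_fin,
      ← mul_pow]
    have h := four_mul_card_nonseparating_le ht.1 ht.2.1
    rw [Fintype.card_fin] at h
    exact Nat.pow_le_pow_left h n
  have hupper : 4 ^ n * ∑ f : Fin n → Fin M → Bool, (nonseparatedTriples f).card ≤
      (pointedPairs M).card * (3 * 2 ^ M) ^ n := by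
    rw [hswap, Finset.mul_sum]
    exact Finset.sum_le_card_nsmul _ _ _ hterm
  have hlower : (2 ^ M) ^ n * M < 2 * ∑ f : Fin n → Fin M → Bool, (nonseparatedTriples f).card := by
    rw [Finset.mul_sum]
    have h := Finset.sum_lt_sum_of_nonempty
      (Finset.univ_nonempty (α := Fin n → Fin M → Bool)) fun f _ => hcon f
    simpa using h
  have htriples := two_mul_card_pointedPairs_le M
  refine lt_irrefl (4 ^ n * ((2 ^ M) ^ n * M)) ?_
  calc 4 ^ n * ((2 ^ M) ^ n * M)
      < 4 ^ n * (2 * ∑ f : Fin n → Fin M → Bool, (nonseparatedTriples f).card) :=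
        Nat.mul_lt_mul_of_pos_left hlower (by positivity)
    _ = 2 * (4 ^ n * ∑ f : Fin n → Fin M → Bool, (nonseparatedTriples f).card) := by ring
    _ ≤ 2 * ((pointedPairs M).card * (3 * 2 ^ M) ^ n) := Nat.mul_le_mul_left 2 hupper
    _ = 2 * (pointedPairs M).card * (3 * 2 ^ M) ^ n := by ring
    _ ≤ M ^ 3 * (3 * 2 ^ M) ^ n := Nat.mul_le_mul_right _ htriples
    _ = M ^ 2 * 3 ^ n * ((2 ^ M) ^ n * M) := by rw [mul_pow]; ring
    _ ≤ 4 ^ n * ((2 ^ M) ^ n * M) := Nat.mul_le_mul_right _ hM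

theorem exists_separating_code_of_sq_mul_le {M : ℕ} (hM3 : 3 ≤ M)
    (hM : M ^ 2 * 3 ^ n ≤ 4 ^ n) :
    ∃ C : Finset (Fin n → Bool), HammingSeparating 2 1 (↑C : Set (Fin n → Bool)) ∧
      M ≤ 2 * C.card := by
  obtain ⟨f, hf⟩ := exists_two_mul_card_nonseparatedTriples_le hM
  let word : Fin M → Fin n → Bool := fun m c => f c m
  let R : Finset (Fin M) := Finset.univ \ (nonseparatedTriples f).image Prod.fst
  have hR_lt : ∀ i ∈ R, ∀ j k, i ≠ j → i ≠ k → j < k →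
      ∃ c, word i c ≠ word j c ∧ word i c ≠ word k c := by
    intro i hi j k hij hik hjk
    by_contra! hcon
    refine (Finset.mem_sdiff.1 hi).2 (Finset.mem_image.2 ⟨(i, j, k), ?_, rfl⟩)
    simp only [nonseparatedTriples, pointedPairs, Finset.mem_filter, Finset.mem_univ, true_and]
    exact ⟨⟨hij, hik, hjk⟩, fun c h => h.2 (hcon c h.1)⟩
  have hR_ne : ∀ i ∈ R, ∀ j k, i ≠ j → i ≠ k → j ≠ k →
      ∃ c, word i c ≠ word j c ∧ word i c ≠ word k c := by
    intro i hi j k hij hik hjk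
    rcases lt_or_gt_of_ne hjk with h | h
    · exact hR_lt i hi j k hij hik h
    · obtain ⟨c, h₁, h₂⟩ := hR_lt i hi k j hik hij h
      exact ⟨c, h₂, h₁⟩
  have hR : ∀ i ∈ R, ∀ j k, i ≠ j → i ≠ k →
      ∃ c, word i c ≠ word j c ∧ word i c ≠ word k c := by
    intro i hi j k hij hik
    rcases eq_or_ne j k with rfl | hjk
    · obtain ⟨l, hl⟩ : ∃ l, l ∉ ({i, j} : Finset (Fin M)) := by
        by_contra! hall
        have h := Finset.card_le_card (fun l (_ : l ∈ Finset.univ) => hall l)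
        have h' := Finset.card_le_two (a := i) (b := j)
        simp only [Finset.card_univ, Fintype.card_fin] at h
        omega
      simp only [Finset.mem_insert, Finset.mem_singleton, not_or] at hl
      obtain ⟨c, hc, -⟩ := hR_ne i hi j l hij (Ne.symm hl.1) (Ne.symm hl.2)
      exact ⟨c, hc, hc⟩
    · exact hR_ne i hi j k hij hik hjk
  have hinj : Set.InjOn word R := by
    intro i hi j _ hij
    by_contra hne
    obtain ⟨c, hc, -⟩ := hR i hi j j hne hne
    exact hc (congrFun hij c)
  refine ⟨R.image word, hammingSeparating_two_one_of_coordinate ?_, ?_⟩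
  · intro x hx y hy z hz hzx hzy
    obtain ⟨j, _, rfl⟩ := Finset.mem_image.1 (Finset.mem_coe.1 hx)
    obtain ⟨k, _, rfl⟩ := Finset.mem_image.1 (Finset.mem_coe.1 hy)
    obtain ⟨i, hi, rfl⟩ := Finset.mem_image.1 (Finset.mem_coe.1 hz)
    exact hR i hi j k (fun h => hzx (h ▸ rfl)) (fun h => hzy (h ▸ rfl))
  · rw [Finset.card_image_of_injOn hinj]
    have h₁ := Finset.le_card_sdiff ((nonseparatedTriples f).image Prod.fst) Finset.univ
    have h₂ := Finset.card_image_le (s := nonseparatedTriples f) (f := Prod.fst)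
    rw [Finset.card_univ, Fintype.card_fin] at h₁
    change _ ≤ R.card at h₁
    omega

/-- Probabilistic lower bound: for every `n ≥ 1` there is a binary `(2,1)`-separating
code of length `n` and cardinality at least `⌊(1/2)·(2/√3)ⁿ⌋`; hence
`κ(n) ≥ ⌊(1/2)·(2/√3)ⁿ⌋`. -/
theorem exists_separating_code_card_ge (n : ℕ) (hn : 1 ≤ n) :
    ∃ C : Finset (Fin n → Bool), HammingSeparating 2 1 (↑C : Set (Fin n → Bool)) ∧
      ⌊(1 / 2 : ℝ) * (2 / Real.sqrt 3) ^ n⌋₊ ≤ C.card := by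
  set L : ℝ := (2 / Real.sqrt 3) ^ n with hL
  have hL0 : 0 ≤ L := by positivity
  have hLsq : L ^ 2 * 3 ^ n = 4 ^ n := by
    rw [hL, ← pow_mul, mul_comm n 2, pow_mul, div_pow, Real.sq_sqrt (by norm_num), ← mul_pow]
    norm_num
  have hfloor : ⌊(1 / 2 : ℝ) * L⌋₊ = ⌊L⌋₊ / 2 := by
    rw [← Nat.floor_div_ofNat]
    congr 1
    ring
  rw [hfloor]
  by_cases hM3 : 3 ≤ ⌊L⌋₊
  · have hM : ⌊L⌋₊ ^ 2 * 3 ^ n ≤ 4 ^ n := by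
      have h : (⌊L⌋₊ : ℝ) ^ 2 * 3 ^ n ≤ 4 ^ n := by
        rw [← hLsq]
        gcongr
        exact Nat.floor_le hL0
      exact_mod_cast h
    obtain ⟨C, hC, hcard⟩ := exists_separating_code_of_sq_mul_le hM3 hM
    exact ⟨C, hC, by omega⟩
  · refine ⟨{fun _ => false}, hammingSeparating_two_one_of_coordinate ?_, ?_⟩
    · intro x hx y _ z hz hzx _
      simp only [Finset.coe_singleton, Set.mem_singleton_iff] at hx hz
      exact absurd (hz.trans hx.symm) hzx
    · rw [Finset.card_singleton]
      omega
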